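/- Let 0 < τ_1 ≤ ... ≤ τ_n, S > 0, and let t = (1/8) min_{j∈[n]} (∑_{i=1}^j 1/τ_i)^{-1} (S + j). Then ∑_{i=1}^n ⌊t/τ_i⌋ ≤ S/4, i.e., in time t the n parallel workers can complete at most S/4 tasks; the proof uses that ⌊x⌋ ≤ 2x − 1/4 for all x ≥ 1/8 and that ⌊t/τ_i⌋ = 0 for indices beyond the largest minimizer j*. -/

import Mathlib

theorem lower_bound_counting (n : ℕ) (hn : 1 ≤ n) (τ : ℕ → ℝ)
    (hpos : ∀ i ∈ Finset.Icc 1 n, 0 < τ i)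
    (hmono : ∀ i j, 1 ≤ i → i ≤ j → j ≤ n → τ i ≤ τ j)
    (S : ℝ) (hS : 0 < S)
    (t : ℝ)
    (ht : t = (1 / 8) * (Finset.Icc 1 n).inf' (Finset.nonempty_Icc.mpr hn)
        (fun j => (S + j) / ∑ i ∈ Finset.Icc 1 j, 1 / τ i)) :
    ∑ i ∈ Finset.Icc 1 n, (⌊t / τ i⌋₊ : ℝ) ≤ S / 4 := by
  have floor_zero : ∀ i ∈ Finset.Icc 1 n, ¬ τ i ≤ t → (⌊t / τ i⌋₊ : ℝ) = 0 := by
    intro i hi h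
    rw [Nat.cast_eq_zero, Nat.floor_eq_zero, div_lt_one (hpos i hi)]
    exact not_le.mp h
  rcases ((Finset.Icc 1 n).filter (fun i => τ i ≤ t)).eq_empty_or_nonempty with he | hne
  · rw [Finset.sum_eq_zero fun i hi => floor_zero i hi (Finset.filter_eq_empty_iff.mp he hi)]
    positivity
  -- Only the workers `1, …, k` with `τ i ≤ t` complete a task.
  obtain ⟨k, hk, hmax⟩ := Finset.exists_max_image _ id hne
  obtain ⟨hkn, hkt⟩ := Finset.mem_filter.mp hk
  obtain ⟨hk1, hkn'⟩ := Finset.mem_Icc.mp hkn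
  have hsub : Finset.Icc 1 k ⊆ Finset.Icc 1 n := Finset.Icc_subset_Icc_right hkn'
  have hsum : 0 < ∑ i ∈ Finset.Icc 1 k, 1 / τ i :=
    Finset.sum_pos (fun i hi => one_div_pos.mpr (hpos i (hsub hi)))
      (Finset.nonempty_Icc.mpr hk1)
  have hbound : 8 * t * ∑ i ∈ Finset.Icc 1 k, 1 / τ i ≤ S + k := by
    rw [← le_div_iff₀ hsum]
    have := Finset.inf'_le (fun j : ℕ => (S + j) / ∑ i ∈ Finset.Icc 1 j, 1 / τ i) hkn
    linarith
  have hfloor : ∀ i ∈ Finset.Icc 1 k, (⌊t / τ i⌋₊ : ℝ) ≤ 2 * t * (1 / τ i) - 1 := by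
    intro i hi
    have hτ := hpos i (hsub hi)
    obtain ⟨hi1, hik⟩ := Finset.mem_Icc.mp hi
    have hone : 1 ≤ t / τ i := (one_le_div hτ).mpr ((hmono i k hi1 hik hkn').trans hkt)
    have hle := Nat.floor_le (zero_le_one.trans hone)
    rw [mul_assoc, mul_one_div]
    linarith
  calc ∑ i ∈ Finset.Icc 1 n, (⌊t / τ i⌋₊ : ℝ)
      = ∑ i ∈ Finset.Icc 1 k, (⌊t / τ i⌋₊ : ℝ) :=
        (Finset.sum_subset hsub fun i hi hik => floor_zero i hi fun hit =>
          hik (Finset.mem_Icc.mpr ⟨(Finset.mem_Icc.mp hi).1,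
            hmax i (Finset.mem_filter.mpr ⟨hi, hit⟩)⟩)).symm
    _ ≤ ∑ i ∈ Finset.Icc 1 k, (2 * t * (1 / τ i) - 1) := Finset.sum_le_sum hfloor
    _ = 2 * t * ∑ i ∈ Finset.Icc 1 k, 1 / τ i - k := by
        rw [Finset.sum_sub_distrib, ← Finset.mul_sum]
        simp
    _ ≤ S / 4 := by
        have : (0 : ℝ) ≤ k := k.cast_nonneg
        linarith
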